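/- arXiv:1702.05873 — 3 statements merged into one kernel-verified Lean document; each statement's English description precedes it below -/
import Mathlib

section
/- If a connected graph G of order at least 2 satisfies odd(G - S) ≤ |S| for all nonempty vertex subsets S, then G has a spanning subgraph in which every component is isomorphic to K₂ or to a cycle; moreover such a spanning subgraph exists containing at most one odd cycle. -/
open SimpleGraph

/-- Number of odd components of the graph obtained from `G` by deleting `S`. -/
noncomputable def oddComp {V : Type*} (G : SimpleGraph V) (S : Set V) : ℕ :=
  Nat.card {C : (G.induce Sᶜ).ConnectedComponent // Odd (Nat.card C.supp)}

/-- Every component of the subgraph `F` is a `K₂` (all degrees one) or a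
cycle (all degrees two). -/
def IsK2CycleFactor {V : Type*} {G : SimpleGraph V} (F : G.Subgraph) : Prop :=
  F.IsSpanning ∧ ∀ C : F.coe.ConnectedComponent,
    (∀ v ∈ C.supp, Nat.card (F.neighborSet ↑v) = 1) ∨
    (∀ v ∈ C.supp, Nat.card (F.neighborSet ↑v) = 2)

/-- The number of components of `F` that are odd cycles. -/
noncomputable def oddCycleCount {V : Type*} {G : SimpleGraph V} (F : G.Subgraph) : ℕ :=
  Nat.card {C : F.coe.ConnectedComponent //
    (∀ v ∈ C.supp, Nat.card (F.neighborSet ↑v) = 2) ∧ Odd (Nat.card C.supp)}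

lemma oddComp_eq {V : Type*} (G : SimpleGraph V) (S : Set V) :
    oddComp G S = (G.induce Sᶜ).oddComponents.ncard := rfl

lemma oddComponents_ncard_iso {V W : Type*} {G : SimpleGraph V} {H : SimpleGraph W}
    (φ : G ≃g H) : G.oddComponents.ncard = H.oddComponents.ncard := by
  refine Nat.card_congr (φ.connectedComponentEquiv.subtypeEquiv fun C => ?_)
  have := Nat.card_congr (ConnectedComponent.isoEquivSupp φ C)
  simp only [Set.mem_ofPred_eq, ← Nat.card_coe_set_eq, this]

lemma odd_oddComp {V : Type*} [Fintype V] (G : SimpleGraph V) (S : Set V) :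
    Odd (oddComp G S) ↔ Odd (Fintype.card V - S.ncard) := by
  rw [oddComp_eq, odd_ncard_oddComponents, Nat.card_coe_set_eq, Set.ncard_compl,
    Nat.card_eq_fintype_card]

lemma exists_partner {V : Type*} [Fintype V] (G : SimpleGraph V) (T : Set V)
    (h : ∀ S : Set V, T ⊆ S → oddComp G S + T.ncard ≤ S.ncard) :
    ∃ f : V → V, ∀ x ∉ T, f x ∉ T ∧ G.Adj x (f x) ∧ f (f x) = x := by
  classical
  obtain ⟨M, hM⟩ : ∃ M : Subgraph (G.induce Tᶜ), M.IsPerfectMatching := by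
    rw [tutte]
    intro U hU
    rw [IsTutteViolator] at hU
    let S : Set V := T ∪ Subtype.val '' U
    have hS := h S Set.subset_union_left
    have hcardS : S.ncard = T.ncard + U.ncard := by
      rw [Set.ncard_union_eq, Set.ncard_image_of_injective _ Subtype.val_injective]
      rw [Set.disjoint_right]
      rintro _ ⟨y, _, rfl⟩
      exact y.2
    let φ : ((⊤ : (G.induce Tᶜ).Subgraph).deleteVerts U).coe ≃g G.induce Sᶜ :=
      { toFun := fun x => ⟨x.1.1, by
          have h1 := x.1.2
          have h2 : x.1 ∉ U := by have := x.2; simp at this; exact this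
          rintro (h3 | ⟨y, hy, hyx⟩)
          · exact h1 h3
          · exact h2 (Subtype.ext hyx ▸ hy)⟩
        invFun := fun x => ⟨⟨x.1, fun hx => x.2 (Or.inl hx)⟩, by
          simp only [Subgraph.deleteVerts_verts, Subgraph.verts_top, Set.mem_sdiff, Set.mem_univ,
            true_and]
          exact fun hx => x.2 (Or.inr ⟨_, hx, rfl⟩)⟩
        left_inv := fun x => rfl
        right_inv := fun x => rfl
        map_rel_iff' := by
          rintro ⟨a, ha⟩ ⟨b, hb⟩
          simp at ha hb
          simp [ha, hb] }
    rw [oddComponents_ncard_iso φ, ← oddComp_eq] at hU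
    omega
  rw [Subgraph.isPerfectMatching_iff] at hM
  choose p hp hu using hM
  refine ⟨fun x => if hx : x ∈ T then x else (p ⟨x, hx⟩).1, fun x hx => ?_⟩
  have h1 : (p ⟨x, hx⟩).1 ∉ T := (p ⟨x, hx⟩).2
  simp only [hx, dite_false, h1]
  refine ⟨not_false, (hp ⟨x, hx⟩).adj_sub, ?_⟩
  have := hu (p ⟨x, hx⟩) ⟨x, hx⟩ (hp ⟨x, hx⟩).symm
  exact (congrArg Subtype.val this).symm

lemma even_card_of_invol {α : Type*} [Finite α] (f : α → α) (h1 : ∀ x, f x ≠ x)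
    (h2 : ∀ x, f (f x) = x) : Even (Nat.card α) := by
  classical
  have := Fintype.ofFinite α
  rw [Nat.card_eq_fintype_card, ← ZMod.natCast_eq_zero_iff_even]
  have := Finset.sum_involution (s := (Finset.univ : Finset α)) (f := fun _ => (1 : ZMod 2))
    (fun x _ => f x) (fun _ _ => by decide) (fun x _ _ => h1 x) (fun _ _ => Finset.mem_univ _)
    (fun x _ => h2 x)
  simpa using this

lemma factor_of_maps {V : Type*} [Fintype V] (G : SimpleGraph V) (f g : V → V) (u : V)
    (hf : ∀ x, G.Adj x (f x)) (hg : ∀ x, G.Adj x (g x))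
    (hsym : ∀ x y, (y = f x ∨ y = g x) → (x = f y ∨ x = g y))
    (hcl : ∀ x, f x = g x → f (f x) = g (f x))
    (hinv : ∀ x, x ≠ u → f (f x) = x) :
    ∃ F : G.Subgraph, IsK2CycleFactor F ∧ oddCycleCount F ≤ 1 := by
  classical
  let F : G.Subgraph :=
    { verts := Set.univ
      Adj := fun x y => y = f x ∨ y = g x
      adj_sub := by
        rintro x y (rfl | rfl)
        · exact hf x
        · exact hg x
      edge_vert := fun _ => Set.mem_univ _
      symm := ⟨hsym⟩ }
  have hn : ∀ x, F.neighborSet x = {f x, g x} := fun x => by ext y; simp [F]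
  have h1 : ∀ x, f x = g x → Nat.card (F.neighborSet x) = 1 := fun x hx => by
    rw [hn, Nat.card_coe_set_eq, hx]; simp
  have h2 : ∀ x, f x ≠ g x → Nat.card (F.neighborSet x) = 2 := fun x hx => by
    rw [hn, Nat.card_coe_set_eq, Set.ncard_pair hx]
  have hstep : ∀ x y : F.verts, F.coe.Adj x y → f x = g x → f y = g y := by
    rintro ⟨x, _⟩ ⟨y, _⟩ hxy hx
    have hxy' : y = f x ∨ y = g x := hxy
    have : y = f x := by rcases hxy' with h | h <;> simp_all
    subst this
    exact hcl x hx
  have hreach : ∀ x y : F.verts, F.coe.Reachable x y → f x = g x → f y = g y := by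
    rintro x y ⟨w⟩
    induction w with
    | nil => exact id
    | cons hadj _ ih => exact fun hx => ih (hstep _ _ hadj hx)
  refine ⟨F, ⟨fun _ => Set.mem_univ _, fun C => ?_⟩, ?_⟩
  · obtain ⟨x, rfl⟩ := C.exists_rep
    by_cases hx : f x = g x
    · left
      intro v hv
      exact h1 _ (hreach _ _ (ConnectedComponent.exact hv).symm hx)
    · right
      intro v hv
      exact h2 _ (fun hv' => hx (hreach _ _ (ConnectedComponent.exact hv) hv'))
  · let u' : F.verts := ⟨u, Set.mem_univ _⟩
    have key : ∀ C : F.coe.ConnectedComponent, Odd (Nat.card C.supp) →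
        C = F.coe.connectedComponentMk u' := by
      intro C hC
      by_contra hne
      have hu : u' ∉ C.supp := fun hmem => hne hmem.symm
      rw [← Nat.not_even_iff_odd] at hC
      apply hC
      refine even_card_of_invol (fun x : C.supp => ⟨⟨f x.1.1, Set.mem_univ _⟩, ?_⟩) ?_ ?_
      · refine C.mem_supp_of_adj_mem_supp x.2 ?_
        exact Or.inl rfl
      · intro x hx
        have : f x.1.1 = x.1.1 := congrArg (fun z : C.supp => z.1.1) hx
        exact (hf x.1.1).ne this.symm
      · intro x
        apply Subtype.ext; apply Subtype.ext
        refine hinv x.1.1 fun hx => hu ?_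
        have : x.1 = u' := Subtype.ext hx
        exact this ▸ x.2
    rw [oddCycleCount]
    have : Subsingleton {C : F.coe.ConnectedComponent //
      (∀ v ∈ C.supp, Nat.card (F.neighborSet ↑v) = 2) ∧ Odd (Nat.card C.supp)} :=
      ⟨fun a b => Subtype.ext ((key _ a.2.2).trans (key _ b.2.2).symm)⟩
    exact Finite.card_le_one_iff_subsingleton |>.mpr this

theorem stmt_4 {V : Type*} [Fintype V] (G : SimpleGraph V)
    (hconn : G.Connected) (hcard : 2 ≤ Fintype.card V)
    (h : ∀ S : Set V, S.Nonempty → oddComp G S ≤ S.ncard) :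
    ∃ F : G.Subgraph, IsK2CycleFactor F ∧ oddCycleCount F ≤ 1 := by
  classical
  have : Nontrivial V := Fintype.one_lt_card_iff_nontrivial.mp hcard
  obtain ⟨u⟩ := hconn.nonempty
  have hle : ∀ S : Set V, S.ncard ≤ Fintype.card V := fun S => by
    rw [← Nat.card_eq_fintype_card, ← Set.ncard_univ]
    exact Set.ncard_le_ncard (Set.subset_univ _)
  rcases Nat.even_or_odd (Fintype.card V) with he | ho
  · obtain ⟨f, hf⟩ := exists_partner G ∅ (by
      intro S _
      rcases S.eq_empty_or_nonempty with rfl | hS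
      · have hpar := odd_oddComp G ∅
        have hsub : oddComp G ∅ ≤ 1 := by
          have hc : (G.induce (∅ : Set V)ᶜ).Connected := by
            rw [Set.compl_empty]
            exact (induceUnivIso G).connected_iff.mpr hconn
          have := hc.preconnected.subsingleton_connectedComponent
          rw [oddComp]
          exact Finite.card_le_one_iff_subsingleton |>.mpr inferInstance
        rw [Set.ncard_empty] at hpar ⊢
        rw [← Nat.not_even_iff_odd, ← Nat.not_even_iff_odd] at hpar
        have : Even (oddComp G ∅) := by simpa [he] using hpar
        rcases this with ⟨k, hk⟩
        omega
      · simpa using h S hS)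
    simp only [Set.mem_empty_iff_false, not_false_iff, true_and, forall_const] at hf
    refine factor_of_maps G f f u (fun x => (hf x).1) (fun x => (hf x).1) ?_ (fun _ _ => rfl)
      (fun x _ => (hf x).2)
    rintro x y (rfl | rfl) <;> exact Or.inl (hf x).2.symm
  · have hpart : ∀ a : V, ∃ f : V → V, ∀ x, x ≠ a → f x ≠ a ∧ G.Adj x (f x) ∧ f (f x) = x := by
      intro a
      obtain ⟨f, hf⟩ := exists_partner G {a} (by
        intro S hS
        have h1 := h S ⟨a, hS rfl⟩
        have hpar := odd_oddComp G S
        have h2 := hle S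
        rw [Set.ncard_singleton]
        rw [Nat.odd_iff] at ho
        rw [Nat.odd_iff, Nat.odd_iff] at hpar
        omega)
      exact ⟨f, by simpa using hf⟩
    obtain ⟨v, huv⟩ := hconn.preconnected.exists_adj_of_nontrivial u
    obtain ⟨f, hf⟩ := hpart u
    obtain ⟨g, hg⟩ := hpart v
    have hne := huv.ne
    have hF : ∀ x, x ≠ u → Function.update f u v x = f x := fun x hx => Function.update_of_ne hx _ _
    have hG : ∀ x, x ≠ v → Function.update g v u x = g x := fun x hx => Function.update_of_ne hx _ _
    have hFu : Function.update f u v u = v := Function.update_self ..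
    have hGv : Function.update g v u v = u := Function.update_self ..
    generalize Function.update f u v = f' at *
    generalize Function.update g v u = g' at *
    have hF1 : ∀ x, x ≠ u → f' x ≠ u ∧ G.Adj x (f' x) ∧ f' (f' x) = x := fun x hx => by
      rw [hF x hx, hF _ (hf x hx).1]; exact hf x hx
    have hG1 : ∀ x, x ≠ v → g' x ≠ v ∧ G.Adj x (g' x) ∧ g' (g' x) = x := fun x hx => by
      rw [hG x hx, hG _ (hg x hx).1]; exact hg x hx
    refine factor_of_maps G f' g' u ?_ ?_ ?_ ?_ (fun x hx => (hF1 x hx).2.2)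
    · intro x
      by_cases hx : x = u
      · rw [hx, hFu]; exact huv
      · exact (hF1 x hx).2.1
    · intro x
      by_cases hx : x = v
      · rw [hx, hGv]; exact huv.symm
      · exact (hG1 x hx).2.1
    · rintro x y (rfl | rfl)
      · by_cases hx : x = u
        · right; rw [hx, hFu, hGv]
        · left; exact (hF1 x hx).2.2.symm
      · by_cases hx : x = v
        · left; rw [hx, hGv, hFu]
        · right; exact (hG1 x hx).2.2.symm
    · intro x hx
      have hxu : x ≠ u := by
        rintro rfl
        exact (hG1 x hne).1 (hx ▸ hFu)
      have hxv : x ≠ v := by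
        rintro rfl
        exact (hF1 x hne.symm).1 (hx.trans hGv)
      rw [(hF1 x hxu).2.2, hx, (hG1 x hxv).2.2]
end

section
/- A connected graph G has an H-factor for every set-valued function H : V(G) → {{1},{0,2}} with |H⁻¹(1)| even if and only if ω(G − S) ≤ |S| + 1 for all subsets S of V(G). -/
open SimpleGraph

/-- Vertices of the auxiliary graph: one copy of each vertex of `A`, two of every other one. -/
abbrev Dbl {V : Type*} (A : Set V) : Type _ := {x : V × Bool // x.1 ∈ A → x.2 = false}

/-- The auxiliary graph. -/
def dblGraph {V : Type*} (G : SimpleGraph V) (A : Set V) : SimpleGraph (Dbl A) where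
  Adj x y := G.Adj x.1.1 y.1.1 ∨ (x.1.1 = y.1.1 ∧ x ≠ y)
  symm := ⟨by
    rintro x y (h | ⟨h, h'⟩)
    · exact Or.inl h.symm
    · exact Or.inr ⟨h.symm, h'.symm⟩⟩
  loopless := ⟨by
    rintro x (h | ⟨h, h'⟩)
    · exact G.loopless.irrefl _ h
    · exact h' rfl⟩

lemma dbl_card {V : Type*} [Fintype V] (A : Set V) :
    Nat.card (Dbl A) + Nat.card A = 2 * Nat.card V := by
  classical
  have e : A ≃ {x : V × Bool // ¬ (x.1 ∈ A → x.2 = false)} :=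
    { toFun := fun a => ⟨(a.1, true), by simp⟩
      invFun := fun x => ⟨x.1.1, by
        have := x.2
        push Not at this
        exact this.1⟩
      left_inv := fun a => rfl
      right_inv := by
        rintro ⟨⟨v, b⟩, h⟩
        simp at h
        simp [h.2] }
  rw [Nat.card_congr e, ← Nat.card_sum, Nat.card_congr (Equiv.sumCompl _), Nat.card_prod]
  simp [mul_comm]

lemma dbl_components {V : Type*} [Fintype V] (G : SimpleGraph V) (A : Set V) (U : Set (Dbl A))
    (S : Set V) (hS : S = {v | ∀ x : Dbl A, x.1.1 = v → x ∈ U}) :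
    Nat.card ((⊤ : (dblGraph G A).Subgraph).deleteVerts U).coe.ConnectedComponent ≤
      Nat.card (G.induce Sᶜ).ConnectedComponent := by
  classical
  have hr : ∀ v : (Sᶜ : Set V), ∃ x : Dbl A, x.1.1 = v.1 ∧ x ∉ U := by
    rintro ⟨v, hv⟩
    rw [hS] at hv
    simp only [Set.mem_compl_iff, Set.mem_ofPred_eq] at hv
    push Not at hv
    exact hv
  choose r hr1 hr2 using hr
  let φ : (G.induce Sᶜ) →g ((⊤ : (dblGraph G A).Subgraph).deleteVerts U).coe :=
    { toFun := fun v => ⟨r v, by simp [hr2]⟩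
      map_rel' := by
        intro a b hab
        have hab' : G.Adj a.1 b.1 := hab
        have : (dblGraph G A).Adj (r a) (r b) := Or.inl (by rw [hr1, hr1]; exact hab')
        simp [hr2, this] }
  apply Nat.card_le_card_of_surjective (ConnectedComponent.map φ)
  intro c
  induction c using ConnectedComponent.ind with
  | h y =>
    obtain ⟨y, hy⟩ := y
    have hyU : y ∉ U := by simpa using hy
    have hyS : y.1.1 ∈ Sᶜ := by
      rw [hS]
      intro h
      exact hyU (h y rfl)
    refine ⟨(G.induce Sᶜ).connectedComponentMk ⟨y.1.1, hyS⟩, ?_⟩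
    rw [ConnectedComponent.map_mk, ConnectedComponent.eq]
    by_cases h : r ⟨y.1.1, hyS⟩ = y
    · have : φ ⟨y.1.1, hyS⟩ = ⟨y, hy⟩ := Subtype.ext h
      rw [this]
    · apply Adj.reachable
      have : (dblGraph G A).Adj (r ⟨y.1.1, hyS⟩) y := Or.inr ⟨hr1 _, h⟩
      simp [φ, hr2, hyU, this]

lemma dbl_matching {V : Type*} [Fintype V] (G : SimpleGraph V) (A : Set V)
    (hA : Even (Nat.card A))
    (h : ∀ S : Set V, Nat.card (G.induce Sᶜ).ConnectedComponent ≤ S.ncard + 1) :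
    ∃ M : (dblGraph G A).Subgraph, M.IsPerfectMatching := by
  classical
  rw [tutte]
  intro U hU
  unfold IsTutteViolator at hU
  have h1 := dbl_components G A U _ rfl
  have h2 := h {v | ∀ x : Dbl A, x.1.1 = v → x ∈ U}
  have h3 : ({v | ∀ x : Dbl A, x.1.1 = v → x ∈ U} : Set V).ncard ≤ U.ncard := by
    apply Set.ncard_le_ncard_of_injOn (fun v => (⟨(v, false), fun _ => rfl⟩ : Dbl A))
    · intro v hv
      exact hv _ rfl
    · intro v _ w _ hvw
      simpa using hvw
  have h4 := Set.ncard_le_card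
    ((⊤ : (dblGraph G A).Subgraph).deleteVerts U).coe.oddComponents
  have h5 := odd_ncard_oddComponents ((⊤ : (dblGraph G A).Subgraph).deleteVerts U).coe
  have h6 : Nat.card ((⊤ : (dblGraph G A).Subgraph).deleteVerts U).verts + U.ncard
      = Nat.card (Dbl A) := by
    rw [Nat.card_coe_set_eq, Subgraph.deleteVerts_verts, Subgraph.verts_top,
      Set.ncard_sdiff_add_ncard_of_subset (Set.subset_univ _), Set.ncard_univ]
  have h7 := dbl_card A
  rw [Nat.odd_iff, Nat.odd_iff] at h5
  rw [Nat.even_iff] at hA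
  omega

lemma suff_dir {V : Type*} [Fintype V] (G : SimpleGraph V) (A : Set V)
    (hA : Even (Nat.card A))
    (h : ∀ S : Set V, Nat.card (G.induce Sᶜ).ConnectedComponent ≤ S.ncard + 1) :
    ∃ F : SimpleGraph V, F ≤ G ∧ ∀ v : V, (v ∈ A → Nat.card (F.neighborSet v) = 1) ∧
      (v ∉ A → Nat.card (F.neighborSet v) = 0 ∨ Nat.card (F.neighborSet v) = 2) := by
  classical
  obtain ⟨M, hM⟩ := dbl_matching G A hA h
  rw [Subgraph.isPerfectMatching_iff] at hM
  choose μ hμ hμu using hM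
  have hinv : ∀ x, μ (μ x) = x := fun x => (hμu _ _ (hμ x).symm).symm
  have hadj : ∀ x, (dblGraph G A).Adj x (μ x) := fun x => (hμ x).adj_sub
  let F : SimpleGraph V :=
    { Adj := fun u v => u ≠ v ∧ ∃! x : Dbl A, x.1.1 = u ∧ (μ x).1.1 = v
      symm := ⟨by
        rintro u v ⟨hne, x, ⟨hx1, hx2⟩, hx3⟩
        refine ⟨hne.symm, μ x, ⟨hx2, by simp only [hinv]; exact hx1⟩, ?_⟩
        rintro y ⟨hy1, hy2⟩
        have := hx3 (μ y) ⟨hy2, by rw [hinv]; exact hy1⟩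
        rw [← this, hinv]⟩
      loopless := ⟨fun u hu => hu.1 rfl⟩ }
  have hF : ∀ u v, F.Adj u v ↔ u ≠ v ∧ ∃! x : Dbl A, x.1.1 = u ∧ (μ x).1.1 = v :=
    fun _ _ => Iff.rfl
  refine ⟨F, ?_, ?_⟩
  · rintro u v ⟨hne, x, ⟨rfl, rfl⟩, -⟩
    rcases hadj x with h1 | ⟨h1, -⟩
    · exact h1
    · exact absurd h1 hne
  · intro v
    constructor
    · intro hv
      have hfib : ∀ x : Dbl A, x.1.1 = v → x = ⟨(v, false), fun _ => rfl⟩ := by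
        rintro ⟨⟨w, b⟩, hx⟩ (rfl : w = v)
        have : b = false := hx hv
        subst this
        rfl
      set a : Dbl A := ⟨(v, false), fun _ => rfl⟩ with ha
      have hne : v ≠ (μ a).1.1 := by
        intro he
        have := hfib _ he.symm
        have h2 := hadj a
        rw [this] at h2
        exact (dblGraph G A).loopless.irrefl _ h2
      have : F.neighborSet v = {(μ a).1.1} := by
        ext w
        rw [mem_neighborSet, hF, Set.mem_singleton_iff]
        constructor
        · rintro ⟨-, x, ⟨hx1, hx2⟩, -⟩
          rw [← hx2, hfib x hx1]
        · rintro rfl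
          exact ⟨hne, a, ⟨rfl, rfl⟩, fun y hy => hfib y hy.1⟩
      rw [this]
      simp
    · intro hv
      set a : Dbl A := ⟨(v, false), fun _ => rfl⟩ with ha
      set b : Dbl A := ⟨(v, true), fun h => absurd h hv⟩ with hb
      have hab : a ≠ b := by simp [ha, hb]
      have ha1 : a.1.1 = v := rfl
      have hb1 : b.1.1 = v := rfl
      have hfib : ∀ x : Dbl A, x.1.1 = v → x = a ∨ x = b := by
        rintro ⟨⟨w, c⟩, hx⟩ (rfl : w = v)
        cases c
        · exact Or.inl rfl
        · exact Or.inr rfl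
      have hμa : μ a ≠ a := fun he => by
        have h2 := hadj a
        rw [he] at h2
        exact (dblGraph G A).loopless.irrefl _ h2
      have hμb : μ b ≠ b := fun he => by
        have h2 := hadj b
        rw [he] at h2
        exact (dblGraph G A).loopless.irrefl _ h2
      by_cases h1 : (μ a).1.1 = (μ b).1.1
      · left
        have : F.neighborSet v = ∅ := by
          ext w
          rw [mem_neighborSet, hF]
          simp only [Set.mem_empty_iff_false, iff_false]
          rintro ⟨-, x, ⟨hx1, hx2⟩, hx3⟩
          have hw : (μ a).1.1 = w ∧ (μ b).1.1 = w := by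
            rcases hfib x hx1 with rfl | rfl
            · exact ⟨hx2, h1 ▸ hx2⟩
            · exact ⟨h1.trans hx2, hx2⟩
          exact hab ((hx3 a ⟨ha1, hw.1⟩).trans (hx3 b ⟨hb1, hw.2⟩).symm)
        rw [this]
        simp
      · right
        have hav : v ≠ (μ a).1.1 := by
          intro he
          rcases hfib _ he.symm with h2 | h2
          · exact hμa h2
          · apply h1
            rw [← h2, hinv, h2]
        have hbv : v ≠ (μ b).1.1 := by
          intro he
          rcases hfib _ he.symm with h2 | h2
          · apply h1
            rw [← h2, hinv, h2]
          · exact hμb h2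
        have : F.neighborSet v = {(μ a).1.1, (μ b).1.1} := by
          ext w
          rw [mem_neighborSet, hF, Set.mem_insert_iff, Set.mem_singleton_iff]
          constructor
          · rintro ⟨-, x, ⟨hx1, hx2⟩, -⟩
            rcases hfib x hx1 with rfl | rfl
            · exact Or.inl hx2.symm
            · exact Or.inr hx2.symm
          · rintro (rfl | rfl)
            · refine ⟨hav, a, ⟨rfl, rfl⟩, fun y hy => ?_⟩
              rcases hfib y hy.1 with h2 | h2
              · exact h2
              · exact absurd (h2 ▸ hy.2).symm h1
            · refine ⟨hbv, b, ⟨rfl, rfl⟩, fun y hy => ?_⟩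
              rcases hfib y hy.1 with h2 | h2
              · exact absurd (h2 ▸ hy.2) h1
              · exact h2
        rw [this, Nat.card_coe_set_eq, Set.ncard_pair h1]

lemma handshake {V : Type*} [Fintype V] (F : SimpleGraph V) (C : Set V) (r : V) (hr : r ∈ C)
    (hcl : ∀ v ∈ C, ∀ w, F.Adj v w → w ∈ C)
    (h1 : Nat.card (F.neighborSet r) = 1)
    (h2 : ∀ v ∈ C, v ≠ r → Even (Nat.card (F.neighborSet v))) : False := by
  classical
  let F' : SimpleGraph V :=
    { Adj := fun u v => F.Adj u v ∧ u ∈ C ∧ v ∈ C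
      symm := ⟨fun u v h => ⟨h.1.symm, h.2.2, h.2.1⟩⟩
      loopless := ⟨fun u h => F.loopless.irrefl _ h.1⟩ }
  have hd : ∀ v, F'.degree v = Nat.card (F'.neighborSet v) := by
    intro v
    rw [Nat.card_eq_fintype_card, card_neighborSet_eq_degree]
  have hin : ∀ v ∈ C, F'.neighborSet v = F.neighborSet v := by
    intro v hv
    ext w
    exact ⟨fun h => h.1, fun h => ⟨h, hv, hcl v hv w h⟩⟩
  have hout : ∀ v, v ∉ C → F'.neighborSet v = ∅ := by
    intro v hv
    ext w
    exact ⟨fun h => hv h.2.1, fun h => h.elim⟩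
  obtain ⟨w, hw, hodd⟩ := F'.exists_ne_odd_degree_of_exists_odd_degree r
    (by rw [hd, hin r hr, h1]; exact odd_one)
  rw [hd] at hodd
  by_cases hwC : w ∈ C
  · rw [hin w hwC] at hodd
    exact Nat.not_odd_iff_even.mpr (h2 w hwC hw) hodd
  · rw [hout w hwC] at hodd
    simp at hodd

lemma nec_dir {V : Type*} [Fintype V] (G : SimpleGraph V)
    (h : ∀ A : Set V, Even A.ncard →
      ∃ F : SimpleGraph V, F ≤ G ∧ ∀ v : V, (v ∈ A → Nat.card (F.neighborSet v) = 1) ∧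
      (v ∉ A → Even (Nat.card (F.neighborSet v))))
    (S : Set V) : Nat.card (G.induce Sᶜ).ConnectedComponent ≤ S.ncard + 1 := by
  classical
  by_contra hlt
  push Not at hlt
  obtain ⟨D, hD1, hD2⟩ : ∃ D : Set (G.induce Sᶜ).ConnectedComponent,
      S.ncard < D.ncard ∧ Even (S.ncard + D.ncard) := by
    rcases Nat.even_or_odd (S.ncard + Nat.card (G.induce Sᶜ).ConnectedComponent) with he | ho
    · refine ⟨Set.univ, ?_, ?_⟩
      · rw [Set.ncard_univ]; omega
      · rwa [Set.ncard_univ]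
    · have hne : Nonempty (G.induce Sᶜ).ConnectedComponent := by
        by_contra hne
        rw [not_nonempty_iff] at hne
        simp at hlt
      obtain ⟨c⟩ := hne
      have hc := Set.ncard_add_ncard_compl ({c} : Set (G.induce Sᶜ).ConnectedComponent)
      rw [Set.ncard_singleton] at hc
      refine ⟨{c}ᶜ, by omega, ?_⟩
      rw [Nat.odd_iff] at ho
      rw [Nat.even_iff]
      omega
  have hrep : ∀ c : (G.induce Sᶜ).ConnectedComponent,
      ∃ v : (Sᶜ : Set V), (G.induce Sᶜ).connectedComponentMk v = c := fun c => c.exists_rep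
  choose r hr using hrep
  have hrinj : Function.Injective (fun c => (r c : V)) := by
    intro c d hcd
    have : r c = r d := Subtype.ext hcd
    rw [← hr c, ← hr d, this]
  have hdisj : Disjoint S ((fun c => (r c : V)) '' D) := by
    rw [Set.disjoint_left]
    rintro v hv ⟨c, -, rfl⟩
    exact (r c).2 hv
  obtain ⟨F, hFG, hF⟩ := h (S ∪ (fun c => (r c : V)) '' D) (by
    rw [Set.ncard_union_eq hdisj, Set.ncard_image_of_injective _ hrinj]
    exact hD2)
  have hedge : ∀ c ∈ D, ∃ s ∈ S, ∃ v : (Sᶜ : Set V),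
      (G.induce Sᶜ).connectedComponentMk v = c ∧ F.Adj s v := by
    intro c hc
    by_contra hno
    push Not at hno
    apply handshake F {v | ∃ hv : v ∈ Sᶜ, (G.induce Sᶜ).connectedComponentMk ⟨v, hv⟩ = c} (r c)
    · exact ⟨(r c).2, hr c⟩
    · rintro v ⟨hv, hvc⟩ w hvw
      have hw : w ∈ Sᶜ := fun hw => hno w hw ⟨v, hv⟩ hvc hvw.symm
      refine ⟨hw, ?_⟩
      rw [← hvc, ConnectedComponent.eq]
      apply Adj.reachable
      exact (hFG hvw).symm
    · exact (hF _).1 (Or.inr ⟨c, hc, rfl⟩)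
    · rintro v ⟨hv, hvc⟩ hne
      apply (hF v).2
      rintro (hvS | ⟨d, hd, rfl⟩)
      · exact hv hvS
      · apply hne
        have : d = c := by rw [← hvc]; exact (hr d).symm
        rw [this]
  obtain ⟨c₀, hc₀⟩ : D.Nonempty := by
    apply Set.nonempty_of_ncard_ne_zero
    omega
  have hne1 : Nonempty (Sᶜ : Set V) := ⟨r c₀⟩
  have hne2 : Nonempty V := ⟨(r c₀).1⟩
  choose! s hs v hv hsv using hedge
  have : D.ncard ≤ S.ncard := by
    apply Set.ncard_le_ncard_of_injOn s hs
    intro c hc d hd hcd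
    have h1 := (hF (s c)).1 (Or.inl (hs c hc))
    rw [Nat.card_coe_set_eq, Set.ncard_eq_one] at h1
    obtain ⟨a, ha⟩ := h1
    have e1 : (v c : V) ∈ F.neighborSet (s c) := hsv c hc
    have e2 : (v d : V) ∈ F.neighborSet (s c) := by rw [hcd]; exact hsv d hd
    rw [ha, Set.mem_singleton_iff] at e1 e2
    have : v c = v d := Subtype.ext (e1.trans e2.symm)
    rw [← hv c hc, ← hv d hd, this]
  omega

theorem stmt_9 {V : Type*} [Fintype V] (G : SimpleGraph V) (hconn : G.Connected) :
    (∀ H : V → Set ℕ, (∀ v, H v = {1} ∨ H v = {0, 2}) →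
      Even (Nat.card {v : V | H v = {1}}) →
      ∃ F : SimpleGraph V, F ≤ G ∧ ∀ v : V, Nat.card (F.neighborSet v) ∈ H v) ↔
    (∀ S : Set V, Nat.card (G.induce Sᶜ).ConnectedComponent ≤ S.ncard + 1) := by
  classical
  have hne : ({0, 2} : Set ℕ) ≠ {1} := by
    intro h
    have : (0 : ℕ) ∈ ({1} : Set ℕ) := h ▸ (by simp)
    simp at this
  constructor
  · intro h
    apply nec_dir
    intro A hA
    have hset : {v : V | (if v ∈ A then ({1} : Set ℕ) else {0, 2}) = {1}} = A := by
      ext v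
      by_cases hv : v ∈ A
      · simp [hv]
      · simp [hv, hne]
    obtain ⟨F, hFG, hF⟩ := h (fun v => if v ∈ A then {1} else {0, 2})
      (fun v => by by_cases hv : v ∈ A <;> simp [hv])
      (by rw [hset]; exact hA)
    refine ⟨F, hFG, fun v => ⟨fun hv => ?_, fun hv => ?_⟩⟩
    · have := hF v
      rw [if_pos hv] at this
      exact this
    · have := hF v
      rw [if_neg hv] at this
      rcases this with h0 | h0
      · rw [h0]; exact Even.zero
      · rw [h0]; exact even_two
  · intro h H hH hev
    obtain ⟨F, hFG, hF⟩ := suff_dir G {v | H v = {1}} hev h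
    refine ⟨F, hFG, fun v => ?_⟩
    by_cases hv : H v = {1}
    · rw [hv]
      exact (hF v).1 hv
    · rw [(hH v).resolve_left hv]
      exact (hF v).2 hv
end

section
/- Let G be a connected graph and f : V(G) → positive odd integers. Then G has an H_f-factor for every set-valued function H_f with |H_f⁻¹(f)| even if and only if ω(G − S) ≤ f(S) + 1 for all S ⊆ V(G). -/
open SimpleGraph

/-- `H_f` assigns each vertex `v` either the odd set `{1,3,…,f(v)}` or the even set
`{0,2,…,2N}` where `2N = max f + 1`. -/
def IsHfShape {V : Type*} [Fintype V] (f : V → ℕ) (H : V → Set ℕ) : Prop :=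
  ∀ v : V, H v = {k : ℕ | Odd k ∧ k ≤ f v} ∨
    H v = {k : ℕ | Even k ∧ k ≤ Finset.univ.sup f + 1}

/-- `H_f⁻¹(f)`: the vertices assigned the odd set. -/
def HfInv {V : Type*} (f : V → ℕ) (H : V → Set ℕ) : Set V :=
  {v : V | H v = {k : ℕ | Odd k ∧ k ≤ f v}}

/-- Blow-up of `G`: each vertex `v` becomes a clique on `b v` vertices. -/
def blowUp {V : Type*} (G : SimpleGraph V) (b : V → ℕ) : SimpleGraph (Σ v, Fin (b v)) where
  Adj x y := G.Adj x.1 y.1 ∨ (x.1 = y.1 ∧ x ≠ y)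
  symm := ⟨fun _ _ h => h.elim (fun h => Or.inl h.symm) (fun h => Or.inr ⟨h.1.symm, h.2.symm⟩)⟩
  loopless := ⟨fun _ h => h.elim (fun h => G.loopless.irrefl _ h) (fun h => h.2 rfl)⟩

open Classical in
lemma factor_of_involution {V : Type*} [Fintype V] (G : SimpleGraph V) (b : V → ℕ)
    (p : (Σ v, Fin (b v)) → (Σ v, Fin (b v))) (hp : ∀ x, p (p x) = x)
    (hadj : ∀ x, (blowUp G b).Adj x (p x)) :
    ∃ F : SimpleGraph V, F ≤ G ∧ ∀ v : V, Nat.card (F.neighborSet v) ≤ b v ∧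
      (Odd (Nat.card (F.neighborSet v)) ↔ Odd (b v)) := by
  let c : V → V → ℕ := fun v w =>
    (Finset.univ.filter (fun x : Σ v, Fin (b v) => x.1 = v ∧ (p x).1 = w)).card
  have csymm : ∀ v w, c v w = c w v := by
    intro v w
    refine Finset.card_bij (fun x _ => p x) ?_ ?_ ?_
    · intro x hx
      simp only [Finset.mem_filter, Finset.mem_univ, true_and] at hx ⊢
      rw [hp]; exact ⟨hx.2, hx.1⟩
    · intro x _ y _ h
      rw [← hp x, ← hp y, h]
    · intro y hy
      simp only [Finset.mem_filter, Finset.mem_univ, true_and] at hy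
      refine ⟨p y, ?_, hp y⟩
      simp only [Finset.mem_filter, Finset.mem_univ, true_and]
      rw [hp]; exact ⟨hy.2, hy.1⟩
  have csum : ∀ v, ∑ w, c v w = b v := by
    intro v
    have h1 : (Finset.univ.filter (fun x : Σ v, Fin (b v) => x.1 = v)).card = b v := by
      have : Finset.univ.filter (fun x : Σ v, Fin (b v) => x.1 = v)
          = (Finset.univ : Finset (Fin (b v))).map (Function.Embedding.sigmaMk v) := by
        ext ⟨w, i⟩
        simp only [Finset.mem_filter, Finset.mem_univ, true_and, Finset.mem_map,
          Function.Embedding.sigmaMk_apply]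
        constructor
        · rintro rfl; exact ⟨i, rfl⟩
        · rintro ⟨j, hj⟩; exact (congrArg Sigma.fst hj).symm
      rw [this]; simp
    rw [← h1, Finset.card_eq_sum_card_fiberwise (f := fun x => (p x).1) (t := Finset.univ)
      (fun _ _ => by simp)]
    refine Finset.sum_congr rfl fun w _ => ?_
    simp only [c, Finset.filter_filter]
  have ceven : ∀ v, ¬ Odd (c v v) := by
    intro v
    rw [Nat.not_odd_iff_even, ← ZMod.natCast_eq_zero_iff_even]
    have : ((c v v : ℕ) : ZMod 2) = ∑ x ∈ Finset.univ.filter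
        (fun x : Σ v, Fin (b v) => x.1 = v ∧ (p x).1 = v), (1 : ZMod 2) := by
      simp [c]
    rw [this]
    refine Finset.sum_involution (fun x _ => p x) (fun _ _ => by decide)
      (fun x _ _ h => (hadj x).ne h.symm) ?_ (fun x _ => hp x)
    intro x hx
    simp only [Finset.mem_filter, Finset.mem_univ, true_and] at hx ⊢
    rw [hp]; exact ⟨hx.2, hx.1⟩
  let F : SimpleGraph V :=
    { Adj := fun v w => Odd (c v w)
      symm := ⟨fun v w h => by rw [csymm]; exact h⟩
      loopless := ⟨fun v h => ceven v h⟩ }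
  refine ⟨F, ?_, ?_⟩
  · intro v w h
    have h' : Odd (c v w) := h
    have hvw : v ≠ w := h.ne
    obtain ⟨x, hx⟩ := Finset.card_pos.1 h'.pos
    simp only [Finset.mem_filter, Finset.mem_univ, true_and] at hx
    have := hadj x
    rcases this with h | h
    · rw [hx.1, hx.2] at h; exact h
    · exact absurd (hx.1.symm.trans (h.1.trans hx.2)) hvw
  · intro v
    have hcard : Nat.card (F.neighborSet v) = (Finset.univ.filter (fun w => Odd (c v w))).card := by
      rw [Nat.card_eq_fintype_card, Fintype.card_subtype]
      rfl
    rw [hcard]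
    constructor
    · rw [← csum v, Finset.card_filter]
      refine Finset.sum_le_sum fun w _ => ?_
      split_ifs with h
      · exact h.pos
      · exact Nat.zero_le _
    · rw [← csum v, Finset.odd_sum_iff_odd_card_odd]

open Classical in
lemma exists_parity_factor {V : Type*} [Fintype V] (G : SimpleGraph V)
    (b : V → ℕ) (hb : ∀ v, 0 < b v) (heven : Even (∑ v, b v))
    (h : ∀ S : Set V,
      Nat.card (G.induce Sᶜ).ConnectedComponent ≤ (∑ v ∈ S.toFinset, b v) + 1) :
    ∃ F : SimpleGraph V, F ≤ G ∧ ∀ v : V, Nat.card (F.neighborSet v) ≤ b v ∧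
      (Odd (Nat.card (F.neighborSet v)) ↔ Odd (b v)) := by
  have hPM : ∃ M : Subgraph (blowUp G b), M.IsPerfectMatching := by
    rw [tutte]
    intro u hu
    unfold IsTutteViolator at hu
    set K := ((⊤ : (blowUp G b).Subgraph).deleteVerts u) with hK
    have hverts : K.verts = uᶜ := by
      ext x; simp [hK]
    -- parity
    have hpar := odd_ncard_oddComponents K.coe
    have hcardV : Nat.card K.verts + u.ncard = ∑ v, b v := by
      have h1 := Set.ncard_add_ncard_compl u
      rw [← hverts] at h1
      have h2 : Nat.card (Σ v, Fin (b v)) = ∑ v, b v := by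
        simp [Nat.card_eq_fintype_card]
      rw [h2] at h1
      rw [Nat.card_coe_set_eq]; omega
    obtain ⟨S, hSdef⟩ : ∃ S : Set V, ∀ v, v ∈ S ↔ ∀ i, (⟨v, i⟩ : Σ v, Fin (b v)) ∈ u :=
      ⟨{v | ∀ i, (⟨v, i⟩ : Σ v, Fin (b v)) ∈ u}, fun _ => Iff.rfl⟩
    have hS := h S
    have hSu : ∑ v ∈ S.toFinset, b v ≤ u.ncard := by
      have : ∑ v ∈ S.toFinset, b v
          = (S.toFinset.sigma (fun v => (Finset.univ : Finset (Fin (b v))))).card := by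
        simp
      rw [this, ← Set.ncard_coe_finset]
      refine Set.ncard_le_ncard ?_ (Set.toFinite _)
      rintro ⟨v, i⟩ hx
      simp only [Finset.coe_sigma, Set.coe_toFinset, Finset.coe_univ, Set.mem_sigma_iff] at hx
      exact (hSdef v).1 hx.1 i
    have hr : ∀ v : (Sᶜ : Set V), ∃ i, (⟨v.1, i⟩ : Σ v, Fin (b v)) ∉ u := by
      rintro ⟨v, hv⟩
      simpa [hSdef] using hv
    choose r hr using hr
    let φ : G.induce Sᶜ →g K.coe :=
      { toFun := fun v => ⟨⟨v.1, r v⟩, by rw [hverts]; exact hr v⟩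
        map_rel' := by
          intro v w hvw
          have h' : (blowUp G b).Adj ⟨v.1, r v⟩ ⟨w.1, r w⟩ := Or.inl hvw
          simp [hK, h', hr] }
    have hsurj : Function.Surjective (ConnectedComponent.map φ) := by
      intro C
      induction C using ConnectedComponent.ind with
      | _ x =>
      obtain ⟨⟨v, i⟩, hx⟩ := x
      have hxu : (⟨v, i⟩ : Σ v, Fin (b v)) ∉ u := by
        rw [hverts] at hx; exact hx
      have hvS : v ∈ Sᶜ := fun hv => hxu ((hSdef v).1 hv i)
      refine ⟨(G.induce Sᶜ).connectedComponentMk ⟨v, hvS⟩, ?_⟩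
      rw [ConnectedComponent.map_mk, ConnectedComponent.eq]
      by_cases hir : r ⟨v, hvS⟩ = i
      · have : φ ⟨v, hvS⟩ = ⟨⟨v, i⟩, hx⟩ := by
          apply Subtype.ext
          change (⟨v, r ⟨v, hvS⟩⟩ : Σ v, Fin (b v)) = ⟨v, i⟩
          rw [hir]
        rw [this]
      · apply Adj.reachable
        have h' : (blowUp G b).Adj ⟨v, r ⟨v, hvS⟩⟩ ⟨v, i⟩ := Or.inr ⟨rfl, by
          intro h; simp at h; exact hir h⟩
        have h3 := hr ⟨v, hvS⟩
        change K.Adj ⟨v, r ⟨v, hvS⟩⟩ ⟨v, i⟩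
        simp [hK, h', hxu, h3]
    have hle : Nat.card K.coe.ConnectedComponent ≤ Nat.card (G.induce Sᶜ).ConnectedComponent :=
      Nat.card_le_card_of_surjective _ hsurj
    have hodd : K.coe.oddComponents.ncard ≤ Nat.card K.coe.ConnectedComponent := by
      rw [← Nat.card_coe_set_eq]
      exact Nat.card_le_card_of_injective _ Subtype.val_injective
    have he : K.coe.oddComponents.ncard = u.ncard + 1 := by omega
    rw [he] at hpar
    rw [← hcardV] at heven
    rw [Nat.even_add, ← Nat.not_odd_iff_even, ← hpar] at heven
    rw [Nat.odd_add_one, Nat.not_odd_iff_even] at heven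
    tauto
  obtain ⟨M, hM⟩ := hPM
  rw [Subgraph.isPerfectMatching_iff] at hM
  choose p hp hu using hM
  exact factor_of_involution G b p (fun x => (hu (p x) x (hp x).symm).symm)
    (fun x => (hp x).adj_sub)

lemma odd_ne_even_set (m n : ℕ) :
    ({k : ℕ | Even k ∧ k ≤ n} : Set ℕ) ≠ {k : ℕ | Odd k ∧ k ≤ m} := by
  intro h
  have h0 : (0 : ℕ) ∈ ({k : ℕ | Even k ∧ k ≤ n} : Set ℕ) := by simp
  rw [h] at h0
  simp at h0

open Classical in
lemma sufficiency {V : Type*} [Fintype V] (G : SimpleGraph V) (hconn : G.Connected)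
    (f : V → ℕ) (hf : ∀ v, Odd (f v))
    (h : ∀ S : Set V,
      Nat.card (G.induce Sᶜ).ConnectedComponent ≤ (∑ᶠ v ∈ S, f v) + 1)
    (H : V → Set ℕ) (hH : IsHfShape f H) (hev : Even (Nat.card (HfInv f H))) :
    ∃ F : SimpleGraph V, F ≤ G ∧ ∀ v : V, Nat.card (F.neighborSet v) ∈ H v := by
  have hne : Nonempty V := hconn.nonempty
  have hsup : Odd (Finset.univ.sup f) := by
    obtain ⟨v, _, hv⟩ := Finset.exists_mem_eq_sup (Finset.univ : Finset V)
      Finset.univ_nonempty f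
    rw [hv]; exact hf v
  let b : V → ℕ := fun v => if v ∈ HfInv f H then f v else Finset.univ.sup f + 1
  have hbodd : ∀ v, Odd (b v) ↔ v ∈ HfInv f H := by
    intro v
    by_cases hv : v ∈ HfInv f H
    · simp [b, hv, hf v]
    · simp only [b, hv, if_false, iff_false, Nat.not_odd_iff_even]
      exact hsup.add_one
  have hfb : ∀ v, f v ≤ b v := by
    intro v
    by_cases hv : v ∈ HfInv f H
    · simp [b, hv]
    · simp only [b, hv, if_false]
      exact (Finset.le_sup (f := f) (Finset.mem_univ v)).trans (Nat.le_succ _)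
  obtain ⟨F, hFG, hF⟩ := exists_parity_factor G b (fun v => (hf v).pos.trans_le (hfb v))
    (by
      rw [Finset.even_sum_iff_even_card_odd]
      simp only [hbodd]
      rwa [Nat.card_eq_fintype_card, Fintype.card_subtype] at hev)
    (by
      intro S
      refine (h S).trans ?_
      rw [finsum_mem_eq_toFinset_sum]
      exact Nat.add_le_add_right (Finset.sum_le_sum fun v _ => hfb v) 1)
  refine ⟨F, hFG, fun v => ?_⟩
  obtain ⟨h1, h2⟩ := hF v
  rw [hbodd] at h2
  by_cases hv : v ∈ HfInv f H
  · have hv' : H v = _ := hv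
    rw [hv']
    refine ⟨h2.2 hv, ?_⟩
    simpa [b, hv] using h1
  · have hv' := (hH v).resolve_left hv
    rw [hv']
    refine ⟨?_, ?_⟩
    · rw [← Nat.not_odd_iff_even, h2]; exact hv
    · simpa [b, hv] using h1

open Classical in
lemma necessity {V : Type*} [Fintype V] (G : SimpleGraph V)
    (f : V → ℕ)
    (h : ∀ H : V → Set ℕ, IsHfShape f H → Even (Nat.card (HfInv f H)) →
      ∃ F : SimpleGraph V, F ≤ G ∧ ∀ v : V, Nat.card (F.neighborSet v) ∈ H v)
    (S : Set V) :
    Nat.card (G.induce Sᶜ).ConnectedComponent ≤ (∑ᶠ v ∈ S, f v) + 1 := by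
  by_contra! hlt
  rw [finsum_mem_eq_toFinset_sum] at hlt
  let 𝒞 := (G.induce Sᶜ).ConnectedComponent
  let mk : (Sᶜ : Set V) → 𝒞 := (G.induce Sᶜ).connectedComponentMk
  have hrep : ∀ C : 𝒞, ∃ v, mk v = C := fun C => C.exists_rep
  choose r hr using hrep
  have hrinj : Function.Injective (fun C => (r C).1) := by
    intro C D hCD
    rw [← hr C, ← hr D, Subtype.ext hCD]
  -- choose the set of odd components
  obtain ⟨R, hRcard, hReven⟩ : ∃ R : Finset 𝒞, (∑ v ∈ S.toFinset, f v) + 1 ≤ R.card ∧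
      Even (S.toFinset.card + R.card) := by
    have hc : Nat.card 𝒞 = (Finset.univ : Finset 𝒞).card := by
      rw [Nat.card_eq_fintype_card, Finset.card_univ]
    by_cases he : Even (S.toFinset.card + Nat.card 𝒞)
    · exact ⟨Finset.univ, by rw [← hc]; exact hlt.le, by rw [← hc]; exact he⟩
    · obtain ⟨R, -, hR⟩ := Finset.exists_subset_card_eq
        (s := (Finset.univ : Finset 𝒞)) (n := Nat.card 𝒞 - 1) (by omega)
      have hlt' : (∑ v ∈ S.toFinset, f v) + 1 < Nat.card 𝒞 := hlt
      refine ⟨R, by omega, ?_⟩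
      rw [hR]
      rw [Nat.even_iff] at he ⊢
      omega
  let O : Finset V := S.toFinset ∪ R.image (fun C => (r C).1)
  have hOcard : O.card = S.toFinset.card + R.card := by
    rw [Finset.card_union_of_disjoint, Finset.card_image_of_injective _ hrinj]
    rw [Finset.disjoint_left]
    intro v hv hv'
    simp only [Finset.mem_image] at hv'
    obtain ⟨C, _, rfl⟩ := hv'
    exact (r C).2 (by simpa using hv)
  let H : V → Set ℕ := fun v => if v ∈ O then {k : ℕ | Odd k ∧ k ≤ f v} else
    {k : ℕ | Even k ∧ k ≤ Finset.univ.sup f + 1}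
  have hInv : HfInv f H = (O : Set V) := by
    ext v
    by_cases hv : v ∈ O
    · simp [HfInv, H, hv]
    · simp [HfInv, H, hv, odd_ne_even_set]
  obtain ⟨F, hFG, hF⟩ := h H
    (by
      intro v
      by_cases hv : v ∈ O
      · left; simp [H, hv]
      · right; simp [H, hv])
    (by
      rw [hInv, Nat.card_coe_set_eq, Set.ncard_coe_finset, hOcard]; exact hReven)
  have hdeg : ∀ v, F.degree v ∈ H v := by
    intro v
    have := hF v
    rwa [Nat.card_eq_fintype_card, card_neighborSet_eq_degree] at this
  have hdegodd : ∀ v, Odd (F.degree v) ↔ v ∈ O := by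
    intro v
    have := hdeg v
    by_cases hv : v ∈ O
    · simp only [H, hv, if_true] at this
      simp [hv, this.1]
    · simp only [H, hv, if_false] at this
      simp only [hv, iff_false, Nat.not_odd_iff_even]
      exact this.1
  -- each component in R sends an edge to S
  have hedge : ∀ C ∈ R, ∃ s ∈ S, ∃ w : (Sᶜ : Set V), mk w = C ∧ F.Adj s w := by
    intro C hC
    by_contra! hno
    let P : V → Prop := fun v => ∃ hv : v ∈ Sᶜ, mk ⟨v, hv⟩ = C
    have hclosed : ∀ v w, F.Adj v w → P v → P w := by
      rintro v w hvw ⟨hv, hvC⟩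
      have hw : w ∈ Sᶜ := fun hw => hno w hw ⟨v, hv⟩ hvC hvw.symm
      refine ⟨hw, ?_⟩
      rw [← hvC]
      apply ConnectedComponent.sound
      apply Adj.reachable
      exact (hFG hvw).symm
    let F' : SimpleGraph V :=
      { Adj := fun v w => F.Adj v w ∧ P v
        symm := ⟨fun v w h => ⟨h.1.symm, hclosed v w h.1 h.2⟩⟩
        loopless := ⟨fun v h => F.loopless.irrefl v h.1⟩ }
    have hF' := F'.even_card_odd_degree_vertices
    have hdeg1 : ∀ v, P v → F'.degree v = F.degree v := by
      intro v hv
      rw [← card_neighborFinset_eq_degree, ← card_neighborFinset_eq_degree]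
      congr 1
      ext w
      simp [F', hv]
    have hdeg0 : ∀ v, ¬ P v → F'.degree v = 0 := by
      intro v hv
      rw [← card_neighborFinset_eq_degree, Finset.card_eq_zero]
      ext w
      simp [F', hv]
    have : Finset.univ.filter (fun v => Odd (F'.degree v)) = {(r C).1} := by
      ext v
      simp only [Finset.mem_filter, Finset.mem_univ, true_and, Finset.mem_singleton]
      constructor
      · intro hv
        by_cases hP : P v
        · rw [hdeg1 v hP, hdegodd] at hv
          obtain ⟨hvS, hvC⟩ := hP
          simp only [O, Finset.mem_union, Set.mem_toFinset, Finset.mem_image] at hv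
          rcases hv with hv | ⟨D, _, hD⟩
          · exact absurd hv hvS
          · have : r D = ⟨v, hvS⟩ := Subtype.ext hD
            rw [← this, hr] at hvC
            rw [← hvC, hD]
        · rw [hdeg0 v hP] at hv
          simp at hv
      · rintro rfl
        rw [hdeg1 _ ⟨(r C).2, hr C⟩, hdegodd]
        simp only [O, Finset.mem_union, Finset.mem_image]
        exact Or.inr ⟨C, hC, rfl⟩
    rw [this] at hF'
    simp at hF'
  obtain ⟨C₀, -⟩ : R.Nonempty := Finset.card_pos.1 (by omega)
  haveI : Nonempty (Sᶜ : Set V) := ⟨r C₀⟩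
  haveI : Nonempty V := ⟨(r C₀).1⟩
  choose! s hs w hw using hedge
  have hcount : R.card ≤ (S.toFinset.sigma (fun v => F.neighborFinset v)).card := by
    refine Finset.card_le_card_of_injOn (fun C => ⟨s C, (w C).1⟩) ?_ ?_
    · intro C hC
      have hC : C ∈ R := hC
      simp [hs C hC, (hw C hC).2]
    · intro C hC D hD hCD
      have hC : C ∈ R := hC
      have hD : D ∈ R := hD
      simp only [Sigma.mk.injEq] at hCD
      rw [← (hw C hC).1, ← (hw D hD).1, Subtype.ext (eq_of_heq hCD.2)]
  rw [Finset.card_sigma] at hcount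
  have : ∑ v ∈ S.toFinset, (F.neighborFinset v).card ≤ ∑ v ∈ S.toFinset, f v := by
    refine Finset.sum_le_sum fun v hv => ?_
    rw [card_neighborFinset_eq_degree]
    have hvO : v ∈ O := Finset.mem_union_left _ hv
    have := hdeg v
    simp only [H, hvO, if_true] at this
    exact this.2
  omega

theorem stmt_12 {V : Type*} [Fintype V] (G : SimpleGraph V) (hconn : G.Connected)
    (f : V → ℕ) (hf : ∀ v, Odd (f v)) :
    (∀ H : V → Set ℕ, IsHfShape f H → Even (Nat.card (HfInv f H)) →
      ∃ F : SimpleGraph V, F ≤ G ∧ ∀ v : V, Nat.card (F.neighborSet v) ∈ H v) ↔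
    (∀ S : Set V,
      Nat.card (G.induce Sᶜ).ConnectedComponent ≤ (∑ᶠ v ∈ S, f v) + 1) :=
  ⟨fun h S => necessity G f h S, fun h H hH hev => sufficiency G hconn f hf h H hH hev⟩
end
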